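/- For every weighted graph G and all positive integers f and k, there exists a graph H with V(H) = V(G) and E(H) ⊆ E(G), together with a linear order on E(H), such that H is an f-EFT (2k−1)-emulator of G and H admits a 2k double-blocking set (with respect to this edge order) of size at most f·|E(H)|. -/

import Mathlib

open SimpleGraph
open scoped ENNReal

noncomputable section

/-- Weighted distance in a graph: the infimum, over all walks from `u` to `v`,
of the total weight of the walk's edges (`⊤` if there is no walk). -/
def wdist {V : Type} (G : SimpleGraph V) (w : Sym2 V → ℝ≥0∞) (u v : V) : ℝ≥0∞ :=
  ⨅ p : G.Walk u v, (p.edges.map w).sum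

/-- Distance in a graph `H` whose edge `(x, y)` is (re)weighted to `δ x y`. -/
def emulDist {V : Type} (H : SimpleGraph V) (δ : V → V → ℝ≥0∞) (u v : V) : ℝ≥0∞ :=
  ⨅ p : H.Walk u v, (p.darts.map (fun d => δ d.toProd.1 d.toProd.2)).sum

/-- `H` is an `f`-edge-fault-tolerant `t`-emulator of the weighted graph `(G, w)`:
for every fault set `F ⊆ E(G)` with `|F| ≤ f`, the graph `H` with every edge `(x,y)`
reweighted to `dist_{G∖F}(x,y)` approximates all distances of `G ∖ F` within factor `t`. -/
def IsEFTEmulator {V : Type} (G : SimpleGraph V) (w : Sym2 V → ℝ≥0∞)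
    (H : SimpleGraph V) (f : ℕ) (t : ℝ≥0∞) : Prop :=
  ∀ F : Finset (Sym2 V), ↑F ⊆ G.edgeSet → F.card ≤ f →
    ∀ u v : V,
      wdist (G.deleteEdges ↑F) w u v ≤ emulDist H (wdist (G.deleteEdges ↑F) w) u v ∧
      emulDist H (wdist (G.deleteEdges ↑F) w) u v ≤ t * wdist (G.deleteEdges ↑F) w u v

/-- `e` is the last edge of the list `l` in the order given by the ranking `π`. -/
def IsLastEdge {V : Type} (π : Sym2 V → ℕ) (l : List (Sym2 V)) (e : Sym2 V) : Prop :=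
  e ∈ l ∧ ∀ e' ∈ l, π e' ≤ π e

/-- The cycle `p` is blocked by the unordered pair `b` of edges: both members of `b`
lie on `p` and one of them is the last edge of `p` in the order `π`. -/
def CycleBlockedBy {V : Type} {H : SimpleGraph V} (π : Sym2 V → ℕ) {u : V}
    (p : H.Walk u u) (b : Sym2 (Sym2 V)) : Prop :=
  ∃ e1 e2 : Sym2 V, b = s(e1, e2) ∧ e1 ∈ p.edges ∧ e2 ∈ p.edges ∧ IsLastEdge π p.edges e1

/-- `B` is a `2k` double-blocking set for `H` with edge order `π`: it consists of
unordered pairs of distinct edges of `H`, every cycle with at most `2k` edges is blocked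
by a member of `B`, and every cycle with at most `k+1` edges is blocked by two
distinct members of `B`. -/
def IsDoubleBlockingSet {V : Type} (H : SimpleGraph V) (π : Sym2 V → ℕ) (k : ℕ)
    (B : Finset (Sym2 (Sym2 V))) : Prop :=
  (∀ b ∈ B, ¬ b.IsDiag ∧ ∀ e ∈ b, e ∈ H.edgeSet) ∧
  (∀ (u : V) (p : H.Walk u u), p.IsCycle → p.length ≤ 2 * k →
      ∃ b ∈ B, CycleBlockedBy π p b) ∧
  (∀ (u : V) (p : H.Walk u u), p.IsCycle → p.length ≤ k + 1 →
      ∃ b1 ∈ B, ∃ b2 ∈ B, b1 ≠ b2 ∧ CycleBlockedBy π p b1 ∧ CycleBlockedBy π p b2)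

/-- The number of pairs of `B` containing the edge `e`. -/
def edgeBlockCount {V : Type} (B : Finset (Sym2 (Sym2 V))) (e : Sym2 V) : ℕ :=
  {b ∈ (B : Set (Sym2 (Sym2 V))) | e ∈ b}.ncard

/-- The `i`-th edge of the vertex sequence `v`. -/
def edgeOf {V : Type} {k : ℕ} (v : Fin (k + 1) → V) (i : Fin k) : Sym2 V :=
  s(v i.castSucc, v i.succ)

/-- The average degree `2|E(H)|/n` of a graph on `n` vertices. -/
def avgDeg {V : Type} [Fintype V] (H : SimpleGraph V) : ℝ :=
  2 * (H.edgeSet.ncard : ℝ) / (Fintype.card V : ℝ)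

end
noncomputable section

/-- `v` is a SCUM `k`-path (for odd `k`), viewed as an oriented sequence of `k+1`
distinct pairwise-adjacent vertices: it is simple, its middle edge (the edge with
0-indexed position `(k-1)/2`, i.e. the index `j` with `2j+1 = k`) is the last edge
of the path in the order `π`, and the two oriented subpaths starting from the middle
edge and going towards either endpoint are chain-unblocked with respect to `B`. -/
def IsSCUM {V : Type} (H : SimpleGraph V) (π : Sym2 V → ℕ) (B : Finset (Sym2 (Sym2 V)))
    (k : ℕ) (v : Fin (k + 1) → V) : Prop :=
  Function.Injective v ∧
  (∀ i : Fin k, H.Adj (v i.castSucc) (v i.succ)) ∧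
  (∀ i j : Fin k, 2 * (j : ℕ) + 1 = k → π (edgeOf v i) ≤ π (edgeOf v j)) ∧
  (∀ (i : Fin k) (j : Fin (k + 1)), 2 * (i : ℕ) + 1 ≤ k → (j : ℕ) + 1 ≤ (i : ℕ) →
      ∀ e' : Sym2 V, s(edgeOf v i, e') ∈ B → v j ∉ e') ∧
  (∀ (i : Fin k) (j : Fin (k + 1)), k ≤ 2 * (i : ℕ) + 1 → (i : ℕ) + 2 ≤ (j : ℕ) →
      ∀ e' : Sym2 V, s(edgeOf v i, e') ∈ B → v j ∉ e')

/-- The number of (oriented) SCUM `k`-paths of `H`. -/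
def scumCount {V : Type} (H : SimpleGraph V) (π : Sym2 V → ℕ)
    (B : Finset (Sym2 (Sym2 V))) (k : ℕ) : ℕ :=
  {v : Fin (k + 1) → V | IsSCUM H π B k v}.ncard

/-- The number of (oriented, aligned) SCUM `k`-path meets of `H`: pairs of distinct
SCUM `k`-paths sharing both endpoints. -/
def scumMeetCount {V : Type} (H : SimpleGraph V) (π : Sym2 V → ℕ)
    (B : Finset (Sym2 (Sym2 V))) (k : ℕ) : ℕ :=
  {vv : (Fin (k + 1) → V) × (Fin (k + 1) → V) |
    IsSCUM H π B k vv.1 ∧ IsSCUM H π B k vv.2 ∧ vv.1 ≠ vv.2 ∧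
    vv.1 0 = vv.2 0 ∧ vv.1 (Fin.last k) = vv.2 (Fin.last k)}.ncard

/-- The oriented path given by the vertex sequence `a` is chain-unblocked with
respect to `B`: for any edge `e` of the path and any vertex `x` strictly following
`e` along the path, no pair `{e, e'} ∈ B` has `e'` incident on `x`. -/
def ChainUnblockedSeq {V : Type} (B : Finset (Sym2 (Sym2 V))) {L : ℕ}
    (a : Fin (L + 1) → V) : Prop :=
  ∀ (i : Fin L) (j : Fin (L + 1)), (i : ℕ) + 2 ≤ (j : ℕ) →
    ∀ e' : Sym2 V, s(edgeOf a i, e') ∈ B → a j ∉ e'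

/-- The walk `p` is blocked: some pair of `B` has both its edges on `p`. -/
def PathBlocked {V : Type} {H : SimpleGraph V} (B : Finset (Sym2 (Sym2 V)))
    {u v : V} (p : H.Walk u v) : Prop :=
  ∃ b ∈ B, ∀ e ∈ b, e ∈ p.edges

/-- The walk `p` is double-blocked: two distinct pairs of `B` have both their edges on `p`. -/
def PathDoubleBlocked {V : Type} {H : SimpleGraph V} (B : Finset (Sym2 (Sym2 V)))
    {u v : V} (p : H.Walk u v) : Prop :=
  ∃ b1 ∈ B, ∃ b2 ∈ B, b1 ≠ b2 ∧ (∀ e ∈ b1, e ∈ p.edges) ∧ (∀ e ∈ b2, e ∈ p.edges)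

/-- The subgraph of `H` consisting of the edge `e` together with all edges
preceding it in the order `π`. -/
def subEdges {V : Type} (H : SimpleGraph V) (π : Sym2 V → ℕ) (e : Sym2 V) : SimpleGraph V :=
  SimpleGraph.fromEdgeSet {e' ∈ H.edgeSet | π e' ≤ π e}

/-- `e` is a core edge of `H` (with respect to edge order `π` and degree threshold `d/4`):
`e` survives in the graph obtained from the subgraph of edges up to `e` by iteratively
deleting vertices of degree at most `d/4`; equivalently, there is a set `S` of vertices
containing both endpoints of `e` on which the subgraph of edges up to `e` induces
a graph of minimum degree greater than `d/4`. -/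
def IsCoreEdge {V : Type} (H : SimpleGraph V) (π : Sym2 V → ℕ) (d : ℝ) (e : Sym2 V) : Prop :=
  e ∈ H.edgeSet ∧
  ∃ S : Set V, (∀ x ∈ e, x ∈ S) ∧
    ∀ v ∈ S, d / 4 < ({u ∈ S | (subEdges H π e).Adj v u}.ncard : ℝ)

end

/-- Every predicate on an element and a set of strictly smaller elements is realised by the set
obtained by deciding membership greedily along the ranking `π`. -/
lemma exists_greedy_set {α : Type*} (π : α → ℕ) (Φ : α → Set α → Prop) :
    ∃ S : Set α, ∀ a, a ∈ S ↔ Φ a {b ∈ S | π b < π a} := by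
  let P : α → Prop := (measure π).wf.fix
    (fun a ih => Φ a {b | ∃ h : π b < π a, ih b h})
  refine ⟨{a | P a}, fun a => ?_⟩
  have h : P a = Φ a {b | ∃ _ : π b < π a, P b} := (measure π).wf.fix_eq _ a
  rw [Set.mem_ofPred_eq, h]
  simp only [exists_prop, and_comm, Set.mem_ofPred_eq]

/-- A finite type with values in a linear order has an injective ranking along which the
values are monotone. -/
lemma exists_injective_ranking {α β : Type*} [Finite α] [LinearOrder β] (w : α → β) :
    ∃ π : α → ℕ, Function.Injective π ∧ ∀ a b, π a ≤ π b → w a ≤ w b := by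
  classical
  obtain ⟨n, ⟨i⟩⟩ := Finite.exists_equiv_fin α
  have := Fintype.ofFinite α
  let key : α → β ×ₗ Fin n := fun a => toLex (w a, i a)
  have hkey : Function.Injective key := fun a b h => i.injective (congrArg (fun x => (ofLex x).2) h)
  have hlt : ∀ a b, key a < key b →
      (Finset.univ.filter fun c => key c < key a).card <
        (Finset.univ.filter fun c => key c < key b).card := by
    intro a b h
    refine Finset.card_lt_card ⟨fun c hc => ?_, fun hs => ?_⟩
    · simp only [Finset.mem_filter, Finset.mem_univ, true_and] at hc ⊢
      exact hc.trans h
    · have : a ∈ Finset.univ.filter fun c => key c < key a := hs (by simpa using h)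
      simp at this
  refine ⟨fun a => (Finset.univ.filter fun c => key c < key a).card, fun a b h => ?_,
    fun a b h => ?_⟩
  · rcases lt_trichotomy (key a) (key b) with h' | h' | h'
    · exact absurd h (hlt _ _ h').ne
    · exact hkey h'
    · exact absurd h (hlt _ _ h').ne'
  · by_contra! hw
    exact absurd h (hlt _ _ (Prod.Lex.toLex_lt_toLex.2 (Or.inl hw))).not_ge

section Distances

variable {V : Type}

lemma wdist_eq_emulDist (G : SimpleGraph V) (w : Sym2 V → ℝ≥0∞) (u v : V) :
    wdist G w u v = emulDist G (fun x y => w s(x, y)) u v := by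
  unfold wdist emulDist Walk.edges
  simp only [List.map_map]
  rfl

lemma emulDist_self (H : SimpleGraph V) (δ : V → V → ℝ≥0∞) (u : V) : emulDist H δ u u = 0 :=
  le_antisymm (iInf_le_of_le Walk.nil (by simp)) zero_le

lemma emulDist_triangle (H : SimpleGraph V) (δ : V → V → ℝ≥0∞) (u v x : V) :
    emulDist H δ u x ≤ emulDist H δ u v + emulDist H δ v x := by
  unfold emulDist
  rw [ENNReal.iInf_add]
  refine le_iInf fun p => ?_
  rw [ENNReal.add_iInf]
  refine le_iInf fun q => ?_
  exact iInf_le_of_le (p.append q) (by simp)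

/-- A bound that is subadditive and holds on each edge of a graph holds for its distance. -/
lemma le_emulDist_of_adj {H : SimpleGraph V} {δ d : V → V → ℝ≥0∞} (h0 : ∀ u, d u u = 0)
    (htri : ∀ u v x, d u x ≤ d u v + d v x) (h : ∀ u v, H.Adj u v → d u v ≤ δ u v) (u v : V) :
    d u v ≤ emulDist H δ u v := by
  refine le_iInf fun p => ?_
  induction p with
  | nil => simp [h0]
  | @cons a b c hab p ih =>
    simp only [Walk.darts_cons, List.map_cons, List.sum_cons]
    exact (htri a b c).trans (add_le_add (h a b hab) ih)

/-- A walk whose edges lie in `K` bounds the distance in `K`. -/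
lemma emulDist_le_sum_edges {H K : SimpleGraph V} {δ : V → V → ℝ≥0∞} {g : Sym2 V → ℝ≥0∞}
    {u v : V} (q : H.Walk u v) (hK : ∀ e ∈ q.edges, e ∈ K.edgeSet)
    (hg : ∀ x y, s(x, y) ∈ q.edges → δ x y ≤ g s(x, y)) :
    emulDist K δ u v ≤ (q.edges.map g).sum := by
  refine iInf_le_of_le (q.transfer K hK) ?_
  rw [← Walk.edges_transfer q hK] at hg ⊢
  rw [Walk.edges, List.map_map]
  refine List.sum_le_sum fun d hd => ?_
  exact hg _ _ (List.mem_map_of_mem hd)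

lemma emulDist_mono {H K : SimpleGraph V} (h : H ≤ K) (δ : V → V → ℝ≥0∞) (u v : V) :
    emulDist K δ u v ≤ emulDist H δ u v := by
  refine le_emulDist_of_adj (emulDist_self K δ) (emulDist_triangle K δ) (fun x y hxy => ?_) u v
  exact iInf_le_of_le (h hxy).toWalk (by simp)

/-- A walk whose edges lie in `K` and have weight at most `c` bounds the distance in `K`. -/
lemma wdist_le_length_mul {H K : SimpleGraph V} {w : Sym2 V → ℝ≥0∞} {c : ℝ≥0∞}
    {u v : V} (q : H.Walk u v) (hK : ∀ e ∈ q.edges, e ∈ K.edgeSet)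
    (hc : ∀ e ∈ q.edges, w e ≤ c) :
    wdist K w u v ≤ q.length * c := by
  rw [wdist_eq_emulDist]
  refine (emulDist_le_sum_edges (g := w) q hK fun _ _ _ => le_rfl).trans ?_
  refine (List.sum_le_card_nsmul _ c ?_).trans_eq (by simp)
  simpa using hc

lemma wdist_le_of_adj {K : SimpleGraph V} {w : Sym2 V → ℝ≥0∞} {x y : V} (h : K.Adj x y) :
    wdist K w x y ≤ w s(x, y) :=
  iInf_le_of_le h.toWalk (by simp)

/-- A walk through the edge `s(u, v)` splits around it. -/
lemma exists_walk_split {H : SimpleGraph V} {u v a b : V} (p : H.Walk a b)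
    (h : s(u, v) ∈ p.edges) :
    (∃ (q : H.Walk a u) (r : H.Walk v b), p.edges = q.edges ++ s(u, v) :: r.edges) ∨
      ∃ (q : H.Walk a v) (r : H.Walk u b), p.edges = q.edges ++ s(u, v) :: r.edges := by
  induction p with
  | nil => simp at h
  | @cons a c b hac p ih =>
    rw [Walk.edges_cons, List.mem_cons] at h
    rcases h with h | h
    · rcases Sym2.eq_iff.1 h with ⟨rfl, rfl⟩ | ⟨rfl, rfl⟩
      · exact Or.inl ⟨Walk.nil, p, by simp⟩
      · exact Or.inr ⟨Walk.nil, p, by simp [Sym2.eq_swap]⟩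
    · rcases ih h with ⟨q, r, hqr⟩ | ⟨q, r, hqr⟩
      · exact Or.inl ⟨q.cons hac, r, by simp [hqr]⟩
      · exact Or.inr ⟨q.cons hac, r, by simp [hqr]⟩

/-- Removing an edge of a closed walk leaves a walk between its endpoints. -/
lemma exists_walk_perm_edges_cons {H : SimpleGraph V} {u v a : V} (p : H.Walk a a)
    (h : s(u, v) ∈ p.edges) :
    ∃ q : H.Walk u v, p.edges.Perm (s(u, v) :: q.edges) := by
  rcases exists_walk_split p h with ⟨q, r, hqr⟩ | ⟨q, r, hqr⟩
  · refine ⟨(r.append q).reverse, ?_⟩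
    rw [hqr, Walk.edges_reverse, Walk.edges_append]
    exact List.perm_middle.trans
      ((List.perm_append_comm.trans (List.reverse_perm _).symm).cons _)
  · refine ⟨r.append q, ?_⟩
    rw [hqr, Walk.edges_append]
    exact List.perm_middle.trans (List.perm_append_comm.cons _)

end Distances

lemma List.Nodup.sum_map_ite_eq_le {α : Type*} [DecidableEq α] {l : List α} (hl : l.Nodup)
    (a : α) (c : ℝ≥0∞) : (l.map fun x => if x = a then c else 0).sum ≤ c := by
  rw [← List.sum_toFinset _ hl, Finset.sum_ite_eq']
  split_ifs <;> simp

section Greedy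

variable {V : Type}

/-- The fault set `F` witnesses that the edge `e` is badly approximated by the edges `S`. -/
def IsFaultWitness (G : SimpleGraph V) (w : Sym2 V → ℝ≥0∞) (f : ℕ) (t : ℝ≥0∞) (S : Set (Sym2 V))
    (e : Sym2 V) (F : Finset (Sym2 V)) : Prop :=
  F.card ≤ f ∧ e ∉ F ∧ ∃ u v, e = s(u, v) ∧
    t * w e < emulDist (fromEdgeSet S) (wdist (G.deleteEdges ↑F) w) u v

/-- If every edge that is not kept has no fault witness, the kept edges form an emulator. -/
lemma isEFTEmulator_of_greedy {G : SimpleGraph V} {w : Sym2 V → ℝ≥0∞} {f : ℕ} {t : ℝ≥0∞}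
    (ht : 1 ≤ t) (ht' : t ≠ ⊤) {H : SimpleGraph V}
    (hH : ∀ e ∈ G.edgeSet, e ∉ H.edgeSet →
      ∃ S ⊆ H.edgeSet, ∀ F, ¬ IsFaultWitness G w f t S e F) :
    IsEFTEmulator G w H f t := by
  intro F _ hF u v
  have hself (x) : wdist (G.deleteEdges ↑F) w x x = 0 := by
    rw [wdist_eq_emulDist, emulDist_self]
  have htri (x y z) : wdist (G.deleteEdges ↑F) w x z ≤
      wdist (G.deleteEdges ↑F) w x y + wdist (G.deleteEdges ↑F) w y z := by
    simp only [wdist_eq_emulDist]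
    exact emulDist_triangle _ _ _ _ _
  refine ⟨le_emulDist_of_adj hself htri (fun _ _ _ => le_rfl) u v, ?_⟩
  have ht0 : t ≠ 0 := (zero_lt_one.trans_le ht).ne'
  rw [mul_comm, ← ENNReal.div_le_iff ht0 ht', wdist_eq_emulDist]
  refine le_emulDist_of_adj
    (d := fun x y => emulDist H (wdist (G.deleteEdges ↑F) w) x y / t) (fun x => ?_)
    (fun x y z => ?_) (fun x y hxy => ?_) u v
  · simp [emulDist_self]
  · rw [← ENNReal.add_div]
    exact ENNReal.div_le_div_right (emulDist_triangle _ _ _ _ _) _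
  · rw [ENNReal.div_le_iff ht0 ht', mul_comm]
    have hxy' := deleteEdges_adj.1 hxy
    by_cases hmem : H.Adj x y
    · calc _ ≤ wdist (G.deleteEdges ↑F) w x y := iInf_le_of_le hmem.toWalk (by simp)
        _ ≤ w s(x, y) := wdist_le_of_adj hxy
        _ ≤ t * w s(x, y) := le_mul_of_one_le_left zero_le ht
    · obtain ⟨S, hS, hSF⟩ := hH s(x, y) hxy'.1 hmem
      by_contra! hlt
      refine hSF F ⟨hF, fun h => hxy'.2 h, x, y, rfl, hlt.trans_le (emulDist_mono ?_ _ _ _)⟩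
      intro a b hab
      exact hS ((fromEdgeSet_adj S).1 hab).1

variable {G H : SimpleGraph V} {w : Sym2 V → ℝ≥0∞} {π : Sym2 V → ℕ} {f : ℕ} {t : ℝ≥0∞}

/-- The rest of a cycle joins the endpoints of its last edge `e` by edges preceding `e`. -/
lemma exists_closing_walk (hπ : Function.Injective π) {e : Sym2 V} {a : V}
    (p : H.Walk a a) (hp : p.IsCycle) (he : IsLastEdge π p.edges e) {u v : V} (huv : e = s(u, v)) :
    ∃ q : H.Walk u v, q.length + 1 = p.length ∧ q.edges.Nodup ∧
      (∀ e' ∈ q.edges, e' ∈ p.edges) ∧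
      ∀ e' ∈ q.edges, e' ∈ (fromEdgeSet {b ∈ H.edgeSet | π b < π e}).edgeSet := by
  subst huv
  obtain ⟨q, hq⟩ := exists_walk_perm_edges_cons p he.1
  have hnd : (s(u, v) :: q.edges).Nodup := hq.nodup_iff.1 hp.edges_nodup
  have hsub : ∀ e' ∈ q.edges, e' ∈ p.edges := fun e' h => hq.mem_iff.2 (List.mem_cons_of_mem _ h)
  refine ⟨q, ?_, hnd.of_cons, hsub, fun e' h => ?_⟩
  · simpa using hq.length_eq.symm
  · have heH := q.edges_subset_edgeSet h
    rw [edgeSet_fromEdgeSet]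
    refine ⟨⟨heH, lt_of_le_of_ne (he.2 e' (hsub e' h)) fun hne => ?_⟩,
      H.not_isDiag_of_mem_edgeSet heH⟩
    exact hnd.notMem (hπ hne ▸ h)

/-- A fault witness of the last edge of a short cycle contains another edge of the cycle. -/
lemma IsFaultWitness.exists_mem (hπ : Function.Injective π) (hπw : ∀ a b, π a ≤ π b → w a ≤ w b)
    (hH : H ≤ G) {k : ℕ} {e : Sym2 V} {a : V} (p : H.Walk a a)
    (hp : p.IsCycle) (hlen : p.length ≤ 2 * k) (he : IsLastEdge π p.edges e)
    {F : Finset (Sym2 V)}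
    (hF : IsFaultWitness G w f ((2 * k - 1 : ℕ) : ℝ≥0∞) {b ∈ H.edgeSet | π b < π e} e F) :
    ∃ e' ∈ p.edges, e' ∈ F := by
  obtain ⟨-, -, u, v, huv, hlt⟩ := hF
  by_contra! hno
  obtain ⟨q, hql, -, hqp, hqS⟩ := exists_closing_walk hπ p hp he huv
  refine hlt.not_ge ?_
  refine (emulDist_le_sum_edges (g := fun _ => w e) q hqS fun x y hxy => ?_).trans ?_
  · refine (wdist_le_of_adj (deleteEdges_adj.2 ⟨hH (q.edges_subset_edgeSet hxy), ?_⟩)).trans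
      (hπw _ _ (he.2 _ (hqp _ hxy)))
    exact fun h => hno _ (hqp _ hxy) h
  · simp only [List.map_const', List.sum_replicate, Walk.length_edges, nsmul_eq_mul]
    gcongr
    omega

/-- A fault witness of the last edge of a very short cycle contains two other edges of it. -/
lemma IsFaultWitness.exists_mem_ne (hπ : Function.Injective π)
    (hπw : ∀ a b, π a ≤ π b → w a ≤ w b)
    (hH : H ≤ G) {k : ℕ} (hk : 0 < k) {e : Sym2 V} {a : V} (p : H.Walk a a)
    (hp : p.IsCycle) (hlen : p.length ≤ k + 1) (he : IsLastEdge π p.edges e)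
    {F : Finset (Sym2 V)}
    (hF : IsFaultWitness G w f ((2 * k - 1 : ℕ) : ℝ≥0∞) {b ∈ H.edgeSet | π b < π e} e F) :
    ∃ e₁ ∈ p.edges, ∃ e₂ ∈ p.edges, e₁ ≠ e₂ ∧ e₁ ∈ F ∧ e₂ ∈ F := by
  classical
  obtain ⟨e₁, he₁, he₁F⟩ := hF.exists_mem hπ hπw hH p hp (by omega) he
  obtain ⟨-, -, u, v, huv, hlt⟩ := hF
  by_contra! hno
  have hno' : ∀ e' ∈ p.edges, e' ∈ F → e' = e₁ := fun e' h hF' => by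
    by_contra hne
    exact hno e₁ he₁ e' h (Ne.symm hne) he₁F hF'
  obtain ⟨q, hql, hqn, hqp, hqS⟩ := exists_closing_walk hπ p hp he huv
  refine hlt.not_ge ?_
  refine (emulDist_le_sum_edges
    (g := fun e' => w e + if e' = e₁ then ((k - 1 : ℕ) : ℝ≥0∞) * w e else 0) q hqS
    fun x y hxy => ?_).trans ?_
  · by_cases hxy₁ : s(x, y) = e₁
    · subst hxy₁
      obtain ⟨r, hr⟩ := exists_walk_perm_edges_cons p he₁
      have hnd : (s(x, y) :: r.edges).Nodup := hr.nodup_iff.1 hp.edges_nodup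
      have hsub : ∀ e' ∈ r.edges, e' ∈ p.edges :=
        fun e' h => hr.mem_iff.2 (List.mem_cons_of_mem _ h)
      have hrl : p.length = r.length + 1 := by simpa using hr.length_eq
      calc wdist (G.deleteEdges ↑F) w x y ≤ r.length * w e := by
            refine wdist_le_length_mul r (fun e' h => ?_) fun e' h => hπw _ _ (he.2 _ (hsub _ h))
            rw [edgeSet_deleteEdges]
            refine ⟨edgeSet_mono hH (r.edges_subset_edgeSet h), fun hF' => ?_⟩
            exact hnd.notMem (hno' e' (hsub e' h) hF' ▸ h)
        _ ≤ ((1 + (k - 1) : ℕ) : ℝ≥0∞) * w e := by gcongr; omega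
        _ = _ := by rw [if_pos rfl, Nat.cast_add, add_mul, Nat.cast_one, one_mul]
    · rw [if_neg hxy₁, add_zero]
      refine (wdist_le_of_adj (deleteEdges_adj.2 ⟨hH (q.edges_subset_edgeSet hxy), ?_⟩)).trans
        (hπw _ _ (he.2 _ (hqp _ hxy)))
      exact fun h => hxy₁ (hno' _ (hqp _ hxy) h)
  · rw [List.sum_map_add]
    calc _ ≤ (q.length : ℝ≥0∞) * w e + ((k - 1 : ℕ) : ℝ≥0∞) * w e := by
          refine add_le_add (by simp) (hqn.sum_map_ite_eq_le _ _)
      _ = ((q.length + (k - 1) : ℕ) : ℝ≥0∞) * w e := by push_cast; ring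
      _ ≤ _ := by gcongr; omega

end Greedy

/-- For every weighted graph `G` and all positive integers `f` and `k`,
there exists a graph `H` with `V(H) = V(G)` and `E(H) ⊆ E(G)`, together with a linear
order on `E(H)`, such that `H` is an `f`-EFT `(2k−1)`-emulator of `G` and `H` admits a
`2k` double-blocking set (with respect to this edge order) of size at most `f·|E(H)|`. -/
theorem statement_6 {V : Type} [Fintype V] (G : SimpleGraph V) (w : Sym2 V → ℝ≥0∞)
    (hw : ∀ e ∈ G.edgeSet, 0 < w e ∧ w e ≠ ⊤) (f k : ℕ) (hf : 0 < f) (hk : 0 < k) :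
    ∃ (H : SimpleGraph V) (π : Sym2 V → ℕ) (B : Finset (Sym2 (Sym2 V))),
      H ≤ G ∧
      Set.InjOn π H.edgeSet ∧
      IsEFTEmulator G w H f ((2 * k - 1 : ℕ) : ℝ≥0∞) ∧
      IsDoubleBlockingSet H π k B ∧
      B.card ≤ f * H.edgeSet.ncard := by
  classical
  obtain ⟨π, hπ, hπw⟩ := exists_injective_ranking w
  let t : ℝ≥0∞ := ((2 * k - 1 : ℕ) : ℝ≥0∞)
  obtain ⟨S, hS⟩ := exists_greedy_set π
    (fun e S => e ∈ G.edgeSet ∧ ∃ F, IsFaultWitness G w f t S e F)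
  have hSG : S ⊆ G.edgeSet := fun e he => ((hS e).1 he).1
  have hHS : (fromEdgeSet S).edgeSet = S := by
    rw [edgeSet_fromEdgeSet, sdiff_eq_left, Set.disjoint_left]
    exact fun e he => G.not_isDiag_of_mem_edgeSet (hSG he)
  have hHG : fromEdgeSet S ≤ G := edgeSet_subset_edgeSet.1 (hHS.trans_subset hSG)
  have hwit : ∀ e ∈ S, ∃ F, IsFaultWitness G w f t {b ∈ S | π b < π e} e F :=
    fun e he => ((hS e).1 he).2
  choose! F hF using hwit
  let B : Finset (Sym2 (Sym2 V)) :=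
    S.toFinset.biUnion fun e => ((F e).filter (· ∈ S)).image fun e' => s(e, e')
  have hB : ∀ e ∈ S, ∀ e' ∈ S, e' ∈ F e → s(e, e') ∈ B := fun e he e' he' hF' =>
    Finset.mem_biUnion.2 ⟨e, Set.mem_toFinset.2 he,
      Finset.mem_image_of_mem _ (Finset.mem_filter.2 ⟨hF', he'⟩)⟩
  have hlast : ∀ (u : V) (p : (fromEdgeSet S).Walk u u), p.IsCycle →
      ∃ e ∈ S, IsLastEdge π p.edges e := by
    intro u p hp
    have hne : p.edges.toFinset.Nonempty := by
      rw [List.toFinset_nonempty_iff, ← List.length_pos_iff, Walk.length_edges]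
      exact (by norm_num : 0 < 3).trans_le hp.three_le_length
    obtain ⟨e, he, hmax⟩ := Finset.exists_max_image _ π hne
    simp only [List.mem_toFinset] at he hmax
    exact ⟨e, hHS ▸ p.edges_subset_edgeSet he, he, hmax⟩
  refine ⟨fromEdgeSet S, π, B, hHG, hπ.injOn, ?_, ⟨?_, ?_, ?_⟩, ?_⟩
  · refine isEFTEmulator_of_greedy ?_ (ENNReal.natCast_ne_top _) fun e heG heS => ?_
    · rw [Nat.one_le_cast]
      omega
    · rw [hHS] at heS ⊢
      refine ⟨{b ∈ S | π b < π e}, Set.sep_subset _ _, fun F' hF' => heS ?_⟩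
      exact (hS e).2 ⟨heG, F', hF'⟩
  · intro b hb
    simp only [B, Finset.mem_biUnion, Set.mem_toFinset, Finset.mem_image, Finset.mem_filter] at hb
    obtain ⟨e, he, e', ⟨hF', he'⟩, rfl⟩ := hb
    rw [hHS]
    refine ⟨fun h => (hF e he).2.1 ?_, fun x hx => ?_⟩
    · rw [Sym2.mk_isDiag_iff] at h
      rwa [← h] at hF'
    · rcases Sym2.mem_iff.1 hx with rfl | rfl <;> assumption
  · intro u p hp hlen
    obtain ⟨e, he, hle⟩ := hlast u p hp
    have hFe := hF e he
    rw [← hHS] at hFe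
    obtain ⟨e', he', hF'⟩ := hFe.exists_mem hπ hπw hHG p hp hlen hle
    exact ⟨s(e, e'), hB e he e' (hHS ▸ p.edges_subset_edgeSet he') hF',
      e, e', rfl, hle.1, he', hle⟩
  · intro u p hp hlen
    obtain ⟨e, he, hle⟩ := hlast u p hp
    have hFe := hF e he
    rw [← hHS] at hFe
    obtain ⟨e₁, he₁, e₂, he₂, hne, hF₁, hF₂⟩ := hFe.exists_mem_ne hπ hπw hHG hk p hp hlen hle
    refine ⟨s(e, e₁), hB e he e₁ (hHS ▸ p.edges_subset_edgeSet he₁) hF₁,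
      s(e, e₂), hB e he e₂ (hHS ▸ p.edges_subset_edgeSet he₂) hF₂,
      fun h => hne (Sym2.congr_right.1 h), ⟨e, e₁, rfl, hle.1, he₁, hle⟩,
      ⟨e, e₂, rfl, hle.1, he₂, hle⟩⟩
  · rw [hHS, Set.ncard_eq_toFinset_card', mul_comm]
    refine Finset.card_biUnion_le_card_mul _ _ _ fun e he => ?_
    exact Finset.card_image_le.trans
      ((Finset.card_filter_le _ _).trans (hF e (Set.mem_toFinset.1 he)).1)
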